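/- Let N ≥ 1 be an integer, X and Z_1, …, Z_N real Hilbert spaces, Y a real inner product space, T, T_n : X → Y (n = 1, 2, …) bounded linear operators, D a linear subspace of X, and L_i : D → Z_i (i = 1, …, N) closed linear operators with closed ranges such that ‖Tx‖² + Σ_{i=1}^N ‖L_i x‖² ≥ k‖x‖² for all x ∈ D and some k > 0. Fix q_i > 1 and α_i > 0 for i = 1, …, N, and let y, y_n ∈ Y with y_n → y, let α_i^n > 0 with α_i^n → α_i as n → ∞ for each i, and assume T_n x → T x uniformly on subsets of D on which all ‖L_i x‖ are bounded. Assume moreover that every subset of D on which ‖Tx‖ + Σ_{i=1}^N ‖L_i x‖ is bounded is relatively compact in X. Let x̄ be the unique global minimizer on D of J(x) = ‖Tx − y‖² + Σ_{i=1}^N α_i ‖L_i x‖^{q_i}, and for each n let x_n be a global minimizer on D of J_n(x) = ‖T_n x − y_n‖² + Σ_{i=1}^N α_i^n ‖L_i x‖^{q_i}. Then x_n converges to x̄ in norm. -/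

import Mathlib

open Filter Topology

theorem le_one_add_rpow {a q : ℝ} (ha : 0 ≤ a) (hq : 1 ≤ q) : a ≤ 1 + a ^ q := by
  rcases le_total a 1 with h | h
  · linarith [Real.rpow_nonneg ha q]
  · linarith [Real.self_le_rpow_of_one_le h hq]

theorem norm_midpoint_rpow_le {E : Type*} [NormedAddCommGroup E] [InnerProductSpace ℝ E]
    {q : ℝ} (hq : 1 ≤ q) (u v : E) :
    ‖(2⁻¹ : ℝ) • (u + v)‖ ^ q ≤ (‖u‖ ^ q + ‖v‖ ^ q) / 2 := by
  have h1 : ‖(2⁻¹ : ℝ) • (u + v)‖ ≤ 2⁻¹ * ‖u‖ + 2⁻¹ * ‖v‖ := by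
    rw [norm_smul, Real.norm_of_nonneg (by norm_num)]
    linarith [norm_add_le u v]
  have h2 := (convexOn_rpow hq).2 (Set.mem_Ici.2 (norm_nonneg u))
    (Set.mem_Ici.2 (norm_nonneg v)) (by norm_num : (0 : ℝ) ≤ 2⁻¹)
    (by norm_num : (0 : ℝ) ≤ 2⁻¹) (by norm_num)
  simp only [smul_eq_mul] at h2
  have h3 := Real.rpow_le_rpow (norm_nonneg _) h1 (zero_le_one.trans hq)
  linarith

theorem norm_sub_sq_eq_midpoint_gap {E : Type*} [NormedAddCommGroup E] [InnerProductSpace ℝ E]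
    (u v : E) :
    ‖u - v‖ ^ 2 = 4 * ((‖u‖ ^ 2 + ‖v‖ ^ 2) / 2 - ‖(2⁻¹ : ℝ) • (u + v)‖ ^ 2) := by
  have h := parallelogram_law_with_norm ℝ u v
  rw [norm_smul, Real.norm_of_nonneg (by norm_num)]
  linarith

/-- Uniform convexity on bounded sets of `‖·‖ ^ q`, `1 < q`, in an inner product space: if the
midpoint convexity gap between `v n` and `a` vanishes in the limit then `v n` tends to `a`. -/
theorem tendsto_of_norm_rpow_midpoint_gap {ι E : Type*} [NormedAddCommGroup E]
    [InnerProductSpace ℝ E] {l : Filter ι} {q : ℝ} (hq : 1 < q) {v : ι → E} {a : E} {c : ℝ}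
    (hv : ∀ᶠ n in l, ‖v n‖ ≤ c)
    (hgap : Tendsto (fun n => (‖v n‖ ^ q + ‖a‖ ^ q) / 2 - ‖(2⁻¹ : ℝ) • (v n + a)‖ ^ q) l (𝓝 0)) :
    Tendsto v l (𝓝 a) := by
  rw [tendsto_iff_ultrafilter]
  intro U hU
  have hq0 : 0 ≤ q := by linarith
  have exists_lim : ∀ (w : ι → ℝ) (b : ℝ), (∀ᶠ n in (U : Filter ι), w n ∈ Set.Icc 0 b) →
      ∃ r ∈ Set.Icc 0 b, Tendsto w U (𝓝 r) := by
    intro w b hw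
    obtain ⟨r, hr, h⟩ := isCompact_Icc.ultrafilter_le_nhds (U.map w) (le_principal_iff.2 hw)
    exact ⟨r, hr, h⟩
  have hvU := hv.filter_mono hU
  have hmid : ∀ n, ‖(2⁻¹ : ℝ) • (v n + a)‖ ≤ (‖v n‖ + ‖a‖) / 2 := by
    intro n
    rw [norm_smul, Real.norm_of_nonneg (by norm_num)]
    linarith [norm_add_le (v n) a]
  obtain ⟨r, hr, hrt⟩ := exists_lim (fun n => ‖v n‖) c
    (hvU.mono fun n h => ⟨norm_nonneg _, h⟩)
  obtain ⟨s, hs, hst⟩ := exists_lim (fun n => ‖(2⁻¹ : ℝ) • (v n + a)‖) ((c + ‖a‖) / 2)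
    (hvU.mono fun n h => ⟨norm_nonneg _, (hmid n).trans (by linarith)⟩)
  have hsr : s ≤ (r + ‖a‖) / 2 :=
    le_of_tendsto_of_tendsto' hst ((hrt.add_const _).div_const 2) hmid
  have heq : (r ^ q + ‖a‖ ^ q) / 2 - s ^ q = 0 :=
    tendsto_nhds_unique
      ((((hrt.rpow_const (Or.inr hq0)).add_const _).div_const 2).sub
        (hst.rpow_const (Or.inr hq0))) (hgap.mono_left hU)
  have hra : r = ‖a‖ := by
    by_contra hne
    have h2 := (strictConvexOn_rpow hq).2 (Set.mem_Ici.2 hr.1)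
      (Set.mem_Ici.2 (norm_nonneg a)) hne (by norm_num : (0 : ℝ) < 2⁻¹)
      (by norm_num : (0 : ℝ) < 2⁻¹) (by norm_num)
    simp only [smul_eq_mul] at h2
    have h3 := Real.rpow_le_rpow hs.1 (hsr.trans_eq (by ring : _ = 2⁻¹ * r + 2⁻¹ * ‖a‖)) hq0
    linarith
  subst hra
  have hsa : s = ‖a‖ :=
    (Real.rpow_left_inj hs.1 hr.1 (zero_lt_one.trans hq).ne').1 (by linarith)
  subst hsa
  have hsq : Tendsto (fun n => ‖v n - a‖ ^ 2) U (𝓝 0) := by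
    simp_rw [norm_sub_sq_eq_midpoint_gap]
    have := ((((hrt.pow 2).add_const (‖a‖ ^ 2)).div_const 2).sub (hst.pow 2)).const_mul 4
    convert this using 2
    ring
  rw [tendsto_iff_norm_sub_tendsto_zero]
  simpa using hsq.sqrt

/-- Strong stability for penalization by a linear combination of powers of seminorms
associated to closed operators (Lemma 4.4): if moreover every subset of `D` on which
`‖Tx‖ + Σᵢ ‖Lᵢx‖` is bounded is relatively compact in `X`, the minimizers of the
perturbed functionals `Jₙ(x) = ‖Tₙx - yₙ‖² + Σᵢ αᵢⁿ ‖Lᵢx‖^{qᵢ}` converge in norm to the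
unique minimizer of `J(x) = ‖Tx - y‖² + Σᵢ αᵢ ‖Lᵢx‖^{qᵢ}`. -/
theorem strong_stability_sum_closed_operator_penalizers
    {N : ℕ} (hN : 1 ≤ N)
    {X Y : Type*} {Z : Fin N → Type*}
    [NormedAddCommGroup X] [InnerProductSpace ℝ X] [CompleteSpace X]
    [∀ i, NormedAddCommGroup (Z i)] [∀ i, InnerProductSpace ℝ (Z i)]
    [∀ i, CompleteSpace (Z i)]
    [NormedAddCommGroup Y] [InnerProductSpace ℝ Y]
    (T : X →L[ℝ] Y) (Tn : ℕ → X →L[ℝ] Y) (D : Submodule ℝ X)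
    (L : ∀ i : Fin N, D →ₗ[ℝ] Z i)
    (hLclosed : ∀ i, IsClosed {p : X × Z i | ∃ x : D, p.1 = (x : X) ∧ p.2 = L i x})
    (hLrange : ∀ i, IsClosed ((LinearMap.range (L i) : Submodule ℝ (Z i)) : Set (Z i)))
    (k : ℝ) (hk : 0 < k)
    (hcompl : ∀ x : D, k * ‖(x : X)‖ ^ 2 ≤ ‖T (x : X)‖ ^ 2 + ∑ i, ‖L i x‖ ^ 2)
    (q α : Fin N → ℝ) (hq : ∀ i, 1 < q i) (hα : ∀ i, 0 < α i)
    (y : Y) (yn : ℕ → Y) (hyconv : Tendsto yn atTop (𝓝 y))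
    (αn : ℕ → Fin N → ℝ) (hαn : ∀ n i, 0 < αn n i)
    (hαconv : ∀ i, Tendsto (fun n => αn n i) atTop (𝓝 (α i)))
    -- Tₙ x → T x uniformly on subsets of D on which all ‖Lᵢ x‖ are bounded
    (hTconsist : ∀ c : ℝ, 0 < c → ∀ ε : ℝ, 0 < ε → ∃ N₀ : ℕ, ∀ n ≥ N₀, ∀ x : D,
      (∀ i, ‖L i x‖ ≤ c) → ‖Tn n (x : X) - T (x : X)‖ < ε)
    -- subsets of D on which ‖Tx‖ + Σᵢ ‖Lᵢx‖ is bounded are relatively compact in X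
    (hcompact : ∀ c : ℝ, IsCompact (closure
      {u : X | ∃ hu : u ∈ D, ‖T u‖ + ∑ i, ‖L i ⟨u, hu⟩‖ ≤ c}))
    -- x̄ is the unique global minimizer of J on D
    (xbar : D)
    (hxbarmin : ∀ x : D,
      ‖T (xbar : X) - y‖ ^ 2 + ∑ i, α i * ‖L i xbar‖ ^ (q i) ≤
        ‖T (x : X) - y‖ ^ 2 + ∑ i, α i * ‖L i x‖ ^ (q i))
    (hxbaruniq : ∀ x' : D,
      (∀ x : D,
        ‖T (x' : X) - y‖ ^ 2 + ∑ i, α i * ‖L i x'‖ ^ (q i) ≤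
          ‖T (x : X) - y‖ ^ 2 + ∑ i, α i * ‖L i x‖ ^ (q i)) →
      x' = xbar)
    -- each xₙ is a global minimizer of Jₙ on D
    (xn : ℕ → D)
    (hxnmin : ∀ n, ∀ x : D,
      ‖Tn n (xn n : X) - yn n‖ ^ 2 + ∑ i, αn n i * ‖L i (xn n)‖ ^ (q i) ≤
        ‖Tn n (x : X) - yn n‖ ^ 2 + ∑ i, αn n i * ‖L i x‖ ^ (q i)) :
    Tendsto (fun n => (xn n : X)) atTop (𝓝 (xbar : X)) := by
  set P : D → ℝ := fun x => ∑ i, α i * ‖L i x‖ ^ (q i) with hP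
  set Pn : ℕ → D → ℝ := fun n x => ∑ i, αn n i * ‖L i x‖ ^ (q i) with hPn
  have hTbar : Tendsto (fun n => Tn n (xbar : X)) atTop (𝓝 (T (xbar : X))) := by
    rw [Metric.tendsto_atTop]
    intro ε hε
    obtain ⟨N₀, h⟩ := hTconsist (∑ i, ‖L i xbar‖ + 1) (by positivity) ε hε
    refine ⟨N₀, fun n hn => ?_⟩
    rw [dist_eq_norm]
    refine h n hn xbar fun i => ?_
    linarith [Finset.single_le_sum (f := fun i => ‖L i xbar‖) (fun j _ => norm_nonneg _)
      (Finset.mem_univ i)]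
  have hJbar : Tendsto (fun n => ‖Tn n (xbar : X) - yn n‖ ^ 2 + Pn n xbar) atTop
      (𝓝 (‖T (xbar : X) - y‖ ^ 2 + P xbar)) :=
    ((hTbar.sub hyconv).norm.pow 2).add
      (tendsto_finsetSum _ fun i _ => (hαconv i).mul_const _)
  set M : ℝ := ‖T (xbar : X) - y‖ ^ 2 + P xbar + 1 with hM
  have hM0 : 0 < M := by
    have : 0 ≤ P xbar := Finset.sum_nonneg fun i _ =>
      mul_nonneg (hα i).le (Real.rpow_nonneg (norm_nonneg _) _)
    positivity
  have hJn : ∀ᶠ n in atTop, ‖Tn n (xn n : X) - yn n‖ ^ 2 + Pn n (xn n) ≤ M := by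
    filter_upwards [hJbar.eventually_le_const (lt_add_one _)] with n hn
    exact (hxnmin n xbar).trans hn
  have hPn_term : ∀ n (x : D) i, 0 ≤ αn n i * ‖L i x‖ ^ (q i) := fun n x i =>
    mul_nonneg (hαn n i).le (Real.rpow_nonneg (norm_nonneg _) _)
  have hLbound : ∀ i, ∀ᶠ n in atTop, ‖L i (xn n)‖ ^ q i ≤ 2 * M / α i := by
    intro i
    filter_upwards [hJn, (hαconv i).eventually_const_le (half_lt_self (hα i))] with n h1 h2
    have h3 : αn n i * ‖L i (xn n)‖ ^ (q i) ≤ Pn n (xn n) :=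
      Finset.single_le_sum (f := fun i => αn n i * ‖L i (xn n)‖ ^ (q i))
        (fun j _ => hPn_term n _ j) (Finset.mem_univ i)
    have h4 := mul_le_mul_of_nonneg_right h2 (Real.rpow_nonneg (norm_nonneg (L i (xn n))) (q i))
    rw [le_div_iff₀ (hα i)]
    nlinarith [sq_nonneg ‖Tn n (xn n : X) - yn n‖]
  set c : ℝ := ∑ i, (1 + 2 * M / α i) + 1 with hc
  have hterm : ∀ i, 0 ≤ 1 + 2 * M / α i := fun i => by have := hα i; positivity
  have hc0 : 0 < c := by
    have := Finset.sum_nonneg fun i (_ : i ∈ Finset.univ) => hterm i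
    linarith
  have hLc : ∀ᶠ n in atTop, ∀ i, ‖L i (xn n)‖ ≤ c := by
    rw [eventually_all]
    intro i
    filter_upwards [hLbound i] with n hn
    have h1 := Finset.single_le_sum (fun j _ => hterm j) (Finset.mem_univ i)
    linarith [le_one_add_rpow (norm_nonneg (L i (xn n))) (hq i).le]
  have hTdiff : Tendsto (fun n => Tn n (xn n : X) - T (xn n : X)) atTop (𝓝 0) := by
    rw [Metric.tendsto_nhds]
    intro ε hε
    obtain ⟨N₀, h⟩ := hTconsist c hc0 ε hε
    filter_upwards [hLc, eventually_ge_atTop N₀] with n h1 h2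
    rw [dist_zero_right]
    exact h n h2 _ h1
  have hres : Tendsto (fun n => ‖T (xn n : X) - y‖ ^ 2 - ‖Tn n (xn n : X) - yn n‖ ^ 2)
      atTop (𝓝 0) := by
    set d : ℕ → ℝ := fun n => ‖(T (xn n : X) - y) - (Tn n (xn n : X) - yn n)‖ with hd
    have hd0 : Tendsto d atTop (𝓝 0) := by
      have h := ((hyconv.sub_const y).sub hTdiff).norm
      simp only [sub_self, norm_zero] at h
      refine h.congr fun n => ?_
      rw [hd]
      congr 1
      abel
    have hbd : Tendsto (fun n => d n * (d n + 2 * (1 + M))) atTop (𝓝 0) := by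
      simpa using hd0.mul (hd0.add_const (2 * (1 + M)))
    refine squeeze_zero_norm' ?_ hbd
    filter_upwards [hJn] with n hn
    have hPnn : 0 ≤ Pn n (xn n) := Finset.sum_nonneg fun i _ => hPn_term n _ i
    have hb : ‖Tn n (xn n : X) - yn n‖ ≤ 1 + M := by
      nlinarith [sq_nonneg (‖Tn n (xn n : X) - yn n‖ - 1)]
    have h1 : |‖T (xn n : X) - y‖ - ‖Tn n (xn n : X) - yn n‖| ≤ d n := abs_norm_sub_norm_le _ _
    rw [Real.norm_eq_abs, sq_sub_sq, mul_comm, abs_mul,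
      abs_of_nonneg (by positivity : 0 ≤ ‖T (xn n : X) - y‖ + ‖Tn n (xn n : X) - yn n‖)]
    refine mul_le_mul h1 ?_ (by positivity) (norm_nonneg _)
    linarith [(abs_le.1 h1).2]
  have hpen : Tendsto (fun n => P (xn n) - Pn n (xn n)) atTop (𝓝 0) := by
    simp only [hP, hPn, ← Finset.sum_sub_distrib, ← sub_mul]
    rw [← Finset.sum_const_zero (s := (Finset.univ : Finset (Fin N)))]
    refine tendsto_finsetSum _ fun i _ => ?_
    have h1 : Tendsto (fun n => |α i - αn n i| * (2 * M / α i)) atTop (𝓝 0) := by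
      simpa using ((hαconv i).const_sub (α i)).abs.mul_const (2 * M / α i)
    refine squeeze_zero_norm' ?_ h1
    filter_upwards [hLbound i] with n hn
    rw [norm_mul, Real.norm_eq_abs, Real.norm_of_nonneg (Real.rpow_nonneg (norm_nonneg _) _)]
    exact mul_le_mul_of_nonneg_left hn (abs_nonneg _)
  set e : ℕ → ℝ := fun n =>
    (‖T (xn n : X) - y‖ ^ 2 - ‖Tn n (xn n : X) - yn n‖ ^ 2) + (P (xn n) - Pn n (xn n)) +
      (‖Tn n (xbar : X) - yn n‖ ^ 2 + Pn n xbar - (‖T (xbar : X) - y‖ ^ 2 + P xbar)) with he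
  have he0 : Tendsto e atTop (𝓝 0) := by
    simpa only [add_zero] using (hres.add hpen).add (tendsto_sub_nhds_zero_iff.2 hJbar)
  set g : ℕ → Fin N → ℝ := fun n i =>
    (‖L i (xn n)‖ ^ q i + ‖L i xbar‖ ^ q i) / 2 -
      ‖(2⁻¹ : ℝ) • (L i (xn n) + L i xbar)‖ ^ q i with hg
  have hg0 : ∀ n i, 0 ≤ g n i := fun n i =>
    sub_nonneg.2 (norm_midpoint_rpow_le (hq i).le _ _)
  have hαg : ∀ n i, 0 ≤ α i * g n i := fun n i => mul_nonneg (hα i).le (hg0 n i)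
  have hmain : ∀ n, ‖T (xn n : X) - T (xbar : X)‖ ^ 2 / 4 + ∑ i, α i * g n i ≤ e n / 2 := by
    intro n
    have hmin := hxbarmin ((2⁻¹ : ℝ) • (xn n + xbar))
    have hmidT : T (((2⁻¹ : ℝ) • (xn n + xbar) : D) : X) - y =
        (2⁻¹ : ℝ) • ((T (xn n : X) - y) + (T (xbar : X) - y)) := by
      simp only [Submodule.coe_smul, Submodule.coe_add, map_smul, map_add]
      module
    have hT := norm_sub_sq_eq_midpoint_gap (T (xn n : X) - y) (T (xbar : X) - y)
    rw [sub_sub_sub_cancel_right] at hT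
    rw [hmidT] at hmin
    simp only [map_smul, map_add] at hmin
    have hsum : ∑ i, α i * g n i = (P (xn n) + P xbar) / 2 -
        ∑ i, α i * ‖(2⁻¹ : ℝ) • (L i (xn n) + L i xbar)‖ ^ q i := by
      simp only [hP, hg, ← Finset.sum_add_distrib, Finset.sum_div, ← Finset.sum_sub_distrib]
      exact Finset.sum_congr rfl fun i _ => by ring
    have hn := hxnmin n xbar
    change _ + P xbar ≤ _ at hmin
    change _ + Pn n (xn n) ≤ _ + Pn n xbar at hn
    simp only [he]
    linarith
  have he2 : Tendsto (fun n => e n / 2) atTop (𝓝 0) := by simpa using he0.div_const 2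
  have hTlim : Tendsto (fun n => ‖T (xn n : X) - T (xbar : X)‖ ^ 2) atTop (𝓝 0) := by
    refine squeeze_zero (fun n => sq_nonneg _) (fun n => ?_)
      (by simpa using he2.const_mul 4 : Tendsto (fun n => 4 * (e n / 2)) atTop (𝓝 0))
    linarith [hmain n, Finset.sum_nonneg fun i (_ : i ∈ Finset.univ) => hαg n i]
  have hLlim : ∀ i, Tendsto (fun n => L i (xn n)) atTop (𝓝 (L i xbar)) := by
    intro i
    refine tendsto_of_norm_rpow_midpoint_gap (hq i) (hLc.mono fun n h => h i) ?_
    refine squeeze_zero (fun n => hg0 n i) (fun n => ?_)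
      (by simpa using he2.div_const (α i) : Tendsto (fun n => e n / 2 / α i) atTop (𝓝 0))
    rw [le_div_iff₀ (hα i), mul_comm]
    change α i * g n i ≤ e n / 2
    have := Finset.single_le_sum (fun j _ => hαg n j) (Finset.mem_univ i)
    linarith [hmain n, sq_nonneg ‖T (xn n : X) - T (xbar : X)‖]
  have hsum0 : Tendsto (fun n => (‖T (xn n : X) - T (xbar : X)‖ ^ 2 +
      ∑ i, ‖L i (xn n) - L i xbar‖ ^ 2) / k) atTop (𝓝 0) := by
    have h := (hTlim.add (tendsto_finsetSum Finset.univ fun i _ =>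
      ((hLlim i).sub_const (L i xbar)).norm.pow 2)).div_const k
    simpa using h
  have hsq : Tendsto (fun n => ‖(xn n : X) - (xbar : X)‖ ^ 2) atTop (𝓝 0) := by
    refine squeeze_zero (fun n => sq_nonneg _) (fun n => ?_) hsum0
    rw [le_div_iff₀ hk, mul_comm]
    simpa using hcompl (xn n - xbar)
  rw [tendsto_iff_norm_sub_tendsto_zero]
  simpa using hsq.sqrt
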